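/- For Lebesgue-almost every irrational x ∈ (0,1), the odd-indexed regular continued fraction digits satisfy liminf_{k→∞} (1/(k log k)) ∑_{i=1}^{k} a_{2i−1}(x) = 1/log 2. -/

import Mathlib

open MeasureTheory Filter Real

/-- The Gauss map `G(y) = 1/y - ⌊1/y⌋` (with `G 0 = 0`). -/
noncomputable def gaussMap (y : ℝ) : ℝ := Int.fract (1 / y)

/-- The `n`-th regular continued fraction digit `a_n(x) = ⌊1 / G^{n-1}(x)⌋`. -/
noncomputable def rcfDigit (x : ℝ) (n : ℕ) : ℕ := (⌊1 / gaussMap^[n - 1] x⌋).toNat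

/-- The first continued fraction digit `⌊1/y⌋`. -/
noncomputable def leadingDigit (y : ℝ) : ℕ := (⌊1 / y⌋).toNat

/-- The Gauss measure, with density `1 / (log 2 * (1 + x))` on `(0,1)`. -/
noncomputable def gaussMeasure : Measure ℝ :=
  (volume.restrict (Set.Ioo (0 : ℝ) 1)).withDensity
    fun x => ENNReal.ofReal (1 / (log 2 * (1 + x)))

/-- The `k`-th inverse branch of the Gauss map, `k ≥ 0`. -/
noncomputable def gaussBranch (k : ℕ) (y : ℝ) : ℝ := 1 / (k + 1 + y)

/-- The weight of the `k`-th branch in the transfer operator of the Gauss measure. -/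
noncomputable def gaussWeight (k : ℕ) (y : ℝ) : ℝ := (1 + y) / ((k + 1 + y) * (k + 2 + y))

lemma measurable_gaussMap : Measurable gaussMap := by
  unfold gaussMap; fun_prop

lemma measurable_leadingDigit : Measurable leadingDigit := by
  unfold leadingDigit
  have h : Measurable fun y : ℝ => 1 / y := by fun_prop
  exact (measurable_from_top (f := Int.toNat)).comp h.floor

lemma measurable_gaussBranch (k : ℕ) : Measurable (gaussBranch k) := by
  unfold gaussBranch; fun_prop

lemma measurable_gaussWeight (k : ℕ) : Measurable (gaussWeight k) := by
  unfold gaussWeight; fun_prop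

lemma gaussWeight_nonneg (k : ℕ) {y : ℝ} (hy : 0 ≤ y) : 0 ≤ gaussWeight k y := by
  unfold gaussWeight; positivity

lemma gaussBranch_mem (k : ℕ) {y : ℝ} (hy : 0 ≤ y) : gaussBranch k y ∈ Set.Icc (0 : ℝ) 1 := by
  have hk : (0 : ℝ) ≤ k := k.cast_nonneg
  unfold gaussBranch
  exact ⟨by positivity, by rw [div_le_one (by positivity)]; linarith⟩

lemma floor_one_div_gaussBranch (k : ℕ) {y : ℝ} (hy : y ∈ Set.Ico (0 : ℝ) 1) :
    ⌊1 / gaussBranch k y⌋ = k + 1 := by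
  rw [gaussBranch, one_div_one_div, Int.floor_eq_iff]
  push_cast
  constructor <;> linarith [hy.1, hy.2]

lemma leadingDigit_gaussBranch (k : ℕ) {y : ℝ} (hy : y ∈ Set.Ico (0 : ℝ) 1) :
    leadingDigit (gaussBranch k y) = k + 1 := by
  rw [leadingDigit, floor_one_div_gaussBranch k hy]; rfl

lemma gaussMap_gaussBranch (k : ℕ) {y : ℝ} (hy : y ∈ Set.Ico (0 : ℝ) 1) :
    gaussMap (gaussBranch k y) = y := by
  rw [gaussMap, Int.fract, floor_one_div_gaussBranch k hy, gaussBranch, one_div_one_div]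
  push_cast; ring

lemma gaussBranch_injOn (k : ℕ) : Set.InjOn (gaussBranch k) (Set.Ico 0 1) := fun y hy z hz h => by
  rw [← gaussMap_gaussBranch k hy, h, gaussMap_gaussBranch k hz]

lemma iUnion_image_gaussBranch :
    ⋃ k, gaussBranch k '' Set.Ico 0 1 = Set.Ioc (0 : ℝ) 1 := by
  ext x
  simp only [Set.mem_iUnion, Set.mem_image]
  constructor
  · rintro ⟨k, y, hy, rfl⟩
    have hk : (0 : ℝ) ≤ k := k.cast_nonneg
    have := hy.1
    exact ⟨by unfold gaussBranch; positivity, (gaussBranch_mem k hy.1).2⟩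
  · rintro ⟨h0, h1⟩
    have h : 1 ≤ ⌊1 / x⌋ := by
      rw [Int.le_floor]; push_cast; rw [le_div_iff₀ h0]; linarith
    obtain ⟨k, hk⟩ := Int.eq_ofNat_of_zero_le (sub_nonneg.2 h)
    refine ⟨k, Int.fract (1 / x), ⟨Int.fract_nonneg _, Int.fract_lt_one _⟩, ?_⟩
    have hk' : (⌊1 / x⌋ : ℝ) = k + 1 := by
      have : ⌊1 / x⌋ = (k : ℤ) + 1 := by omega
      rw [this]; push_cast; ring
    rw [gaussBranch, Int.fract, hk']
    simp

lemma pairwise_disjoint_image_gaussBranch :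
    Pairwise (Function.onFun Disjoint fun k => gaussBranch k '' Set.Ico 0 1) := by
  intro k l hkl
  refine Set.disjoint_left.2 ?_
  rintro _ ⟨y, hy, rfl⟩ ⟨z, hz, h⟩
  have h1 := leadingDigit_gaussBranch k hy
  rw [← h, leadingDigit_gaussBranch l hz] at h1
  omega

lemma hasDerivAt_gaussBranch (k : ℕ) {y : ℝ} (hy : 0 ≤ y) :
    HasDerivAt (gaussBranch k) (-1 / (k + 1 + y) ^ 2) y := by
  have h : (k : ℝ) + 1 + y ≠ 0 := by positivity
  have h1 : HasDerivAt (fun y : ℝ => (k : ℝ) + 1 + y) 1 y := (hasDerivAt_id y).const_add _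
  have h2 := h1.fun_inv h
  simp only [← one_div] at h2
  exact h2

/-- Change of variables along the branches of the Gauss map. -/
lemma setLIntegral_eq_tsum_gaussBranch (F : ℝ → ENNReal) :
    ∫⁻ x in Set.Ioo (0 : ℝ) 1, F x =
      ∑' k : ℕ, ∫⁻ y in Set.Ioo (0 : ℝ) 1,
        ENNReal.ofReal (1 / (k + 1 + y) ^ 2) * F (gaussBranch k y) := by
  have hd : ∀ k : ℕ, ∀ y ∈ Set.Ico (0 : ℝ) 1,
      HasDerivWithinAt (gaussBranch k) (-1 / (k + 1 + y) ^ 2) (Set.Ico 0 1) y :=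
    fun k y hy => (hasDerivAt_gaussBranch k hy.1).hasDerivWithinAt
  have hm : ∀ k, MeasurableSet (gaussBranch k '' Set.Ico 0 1) := fun k =>
    measurableSet_Ico.image_of_measurable_injOn (measurable_gaussBranch k) (gaussBranch_injOn k)
  rw [setLIntegral_congr Ioo_ae_eq_Ioc, ← iUnion_image_gaussBranch,
    lintegral_iUnion hm pairwise_disjoint_image_gaussBranch]
  refine tsum_congr fun k => ?_
  rw [lintegral_image_eq_lintegral_abs_deriv_mul measurableSet_Ico (hd k) (gaussBranch_injOn k),
    setLIntegral_congr Ioo_ae_eq_Ico]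
  refine setLIntegral_congr_fun measurableSet_Ico fun y hy => ?_
  simp only [abs_div, abs_neg, abs_one, abs_pow, sq_abs]

lemma measurable_gaussDensity :
    Measurable fun x : ℝ => ENNReal.ofReal (1 / (log 2 * (1 + x))) := by
  fun_prop

lemma lintegral_gaussMeasure {F : ℝ → ENNReal} (hF : Measurable F) :
    ∫⁻ x, F x ∂gaussMeasure =
      ∫⁻ x in Set.Ioo (0 : ℝ) 1, ENNReal.ofReal (1 / (log 2 * (1 + x))) * F x := by
  rw [gaussMeasure, lintegral_withDensity_eq_lintegral_mul _ measurable_gaussDensity hF]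
  rfl

lemma gaussMeasure_ae_mem : ∀ᵐ x ∂gaussMeasure, x ∈ Set.Ioo (0 : ℝ) 1 :=
  (withDensity_absolutelyContinuous _ _).ae_le (ae_restrict_mem measurableSet_Ioo)

lemma restrict_absolutelyContinuous_gaussMeasure :
    volume.restrict (Set.Ioo (0 : ℝ) 1) ≪ gaussMeasure := by
  refine withDensity_absolutelyContinuous' measurable_gaussDensity.aemeasurable ?_
  filter_upwards [ae_restrict_mem measurableSet_Ioo] with x hx
  have := hx.1
  have := log_pos one_lt_two
  simpa using by positivity

instance isProbabilityMeasure_gaussMeasure : IsProbabilityMeasure gaussMeasure := by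
  constructor
  have hl := log_pos one_lt_two
  rw [← lintegral_one, lintegral_gaussMeasure measurable_const]
  simp only [mul_one]
  have hc : ContinuousOn (fun x : ℝ => 1 / (log 2 * (1 + x))) (Set.Icc 0 1) := by
    refine continuousOn_const.div (by fun_prop) fun x hx => ?_
    have := hx.1
    positivity
  rw [setLIntegral_congr Ioo_ae_eq_Ioc, ← ofReal_integral_eq_lintegral_ofReal
    ((hc.integrableOn_Icc).mono_set Set.Ioc_subset_Icc_self), ← intervalIntegral.integral_of_le zero_le_one]
  · have : ∀ x : ℝ, 1 / (log 2 * (1 + x)) = (log 2)⁻¹ * (1 + x)⁻¹ := fun x => by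
      rw [one_div, mul_inv]
    simp only [this, intervalIntegral.integral_const_mul]
    rw [intervalIntegral.integral_comp_add_left (fun x => x⁻¹), integral_inv]
    · norm_num [hl.ne']
    · norm_num [Set.uIcc_of_le]
  · filter_upwards [ae_restrict_mem measurableSet_Ioc] with x hx
    have := hx.1
    simp only [Pi.zero_apply]
    positivity

/-- The transfer operator of the Gauss map is dual to composition with the Gauss map. -/
lemma lintegral_mul_comp_gaussMap {f g : ℝ → ENNReal} (hf : Measurable f) (hg : Measurable g) :
    ∫⁻ x, f x * g (gaussMap x) ∂gaussMeasure =
      ∫⁻ y, (∑' k, ENNReal.ofReal (gaussWeight k y) * f (gaussBranch k y)) * g y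
        ∂gaussMeasure := by
  have hw : ∀ k, Measurable fun y =>
      ENNReal.ofReal (gaussWeight k y) * f (gaussBranch k y) := fun k =>
    (measurable_gaussWeight k).ennreal_ofReal.mul (hf.comp (measurable_gaussBranch k))
  rw [lintegral_gaussMeasure (F := fun x => f x * g (gaussMap x))
      (hf.mul (hg.comp measurable_gaussMap)),
    lintegral_gaussMeasure (F := fun y => (∑' k, _) * g y)
      ((Measurable.tsum hw).mul hg),
    setLIntegral_eq_tsum_gaussBranch]
  simp_rw [← ENNReal.tsum_mul_right, ← ENNReal.tsum_mul_left]
  rw [lintegral_tsum (f := fun k y => ENNReal.ofReal (1 / (log 2 * (1 + y))) *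
    (ENNReal.ofReal (gaussWeight k y) * f (gaussBranch k y) * g y))
    fun k => (measurable_gaussDensity.mul ((hw k).mul hg)).aemeasurable]
  refine tsum_congr fun k => setLIntegral_congr_fun measurableSet_Ioo fun y hy => ?_
  have hk : (0 : ℝ) ≤ k := k.cast_nonneg
  have h0 := hy.1
  have hl := log_pos one_lt_two
  simp only [gaussMap_gaussBranch k (Set.Ioo_subset_Ico_self hy)]
  rw [← mul_assoc, ← mul_assoc, ← mul_assoc, ← mul_assoc, ← ENNReal.ofReal_mul (by positivity),
    ← ENNReal.ofReal_mul (by positivity)]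
  congr 3
  unfold gaussBranch gaussWeight
  field_simp
  ring

lemma sum_gaussWeight (n : ℕ) {y : ℝ} (hy : 0 ≤ y) :
    ∑ k ∈ Finset.range n, gaussWeight k y = 1 - (1 + y) / (n + 1 + y) := by
  induction n with
  | zero => simp [div_self (by positivity : 1 + y ≠ 0)]
  | succ n ih =>
    rw [Finset.sum_range_succ, ih, gaussWeight]
    push_cast
    have h1 : (n : ℝ) + 1 + y ≠ 0 := by positivity
    have h2 : (n : ℝ) + 2 + y ≠ 0 := by positivity
    have h3 : (n : ℝ) + 1 + 1 + y ≠ 0 := by positivity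
    field_simp
    ring

lemma tendsto_one_add_div (y : ℝ) :
    Tendsto (fun n : ℕ => (1 + y) / (n + 1 + y)) atTop (nhds 0) := by
  refine tendsto_const_nhds.div_atTop ?_
  exact tendsto_atTop_add_const_right _ _
    (tendsto_atTop_add_const_right _ _ tendsto_natCast_atTop_atTop)

lemma hasSum_gaussWeight {y : ℝ} (hy : 0 ≤ y) : HasSum (fun k => gaussWeight k y) 1 := by
  rw [hasSum_iff_tendsto_nat_of_nonneg fun k => gaussWeight_nonneg k hy]
  simp_rw [sum_gaussWeight _ hy]
  simpa using (tendsto_one_add_div y).const_sub 1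

lemma measurePreserving_gaussMap : MeasurePreserving gaussMap gaussMeasure gaussMeasure := by
  refine ⟨measurable_gaussMap, ?_⟩
  ext s hs
  rw [Measure.map_apply measurable_gaussMap hs,
    ← lintegral_indicator_one (measurable_gaussMap hs), ← lintegral_indicator_one hs]
  have h := lintegral_mul_comp_gaussMap (f := fun _ => 1) (g := s.indicator 1) measurable_const
    (measurable_one.indicator hs)
  simp only [one_mul, mul_one] at h
  refine (h.trans (lintegral_congr_ae ?_))
  filter_upwards [gaussMeasure_ae_mem] with y hy
  rw [← ENNReal.ofReal_tsum_of_nonneg (fun k => gaussWeight_nonneg k hy.1.le)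
    (hasSum_gaussWeight hy.1.le).summable, (hasSum_gaussWeight hy.1.le).tsum_eq]
  simp

/-- The transfer operator of the Gauss map with respect to the Gauss measure. -/
noncomputable def gaussTransfer (f : ℝ → ℝ) (y : ℝ) : ℝ :=
  ∑' k, gaussWeight k y * f (gaussBranch k y)

/-- `f` is `L`-Lipschitz on the unit interval. -/
def UnitLipschitz (L : ℝ) (f : ℝ → ℝ) : Prop :=
  ∀ x ∈ Set.Icc (0 : ℝ) 1, ∀ y ∈ Set.Icc (0 : ℝ) 1, |f x - f y| ≤ L * |x - y|

lemma UnitLipschitz.nonneg {L : ℝ} {f : ℝ → ℝ} (hf : UnitLipschitz L f) : 0 ≤ L := by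
  have h := (abs_nonneg _).trans (hf 0 (by norm_num) 1 (by norm_num))
  simpa using h

lemma UnitLipschitz.abs_le {L : ℝ} {f : ℝ → ℝ} (hf : UnitLipschitz L f) {x : ℝ}
    (hx : x ∈ Set.Icc (0 : ℝ) 1) : |f x| ≤ |f 0| + L := by
  have h := hf x hx 0 (by norm_num)
  have h1 : |x - 0| ≤ 1 := by rw [sub_zero, abs_of_nonneg hx.1]; exact hx.2
  have h2 := mul_le_mul_of_nonneg_left h1 hf.nonneg
  have h3 := abs_sub_abs_le_abs_sub (f x) (f 0)
  linarith

lemma measurable_gaussTransfer {f : ℝ → ℝ} (hf : Measurable f) : Measurable (gaussTransfer f) :=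
  Measurable.tsum fun k => (measurable_gaussWeight k).mul (hf.comp (measurable_gaussBranch k))

lemma gaussTransfer_nonneg {f : ℝ → ℝ} (h0 : ∀ x ∈ Set.Icc (0 : ℝ) 1, 0 ≤ f x) {y : ℝ}
    (hy : 0 ≤ y) : 0 ≤ gaussTransfer f y :=
  tsum_nonneg fun k => mul_nonneg (gaussWeight_nonneg k hy) (h0 _ (gaussBranch_mem k hy))

lemma UnitLipschitz.summable_gaussWeight_mul {L : ℝ} {f : ℝ → ℝ} (hf : UnitLipschitz L f)
    {y : ℝ} (hy : 0 ≤ y) : Summable fun k => gaussWeight k y * f (gaussBranch k y) := by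
  refine Summable.of_norm_bounded ((hasSum_gaussWeight hy).summable.mul_right (|f 0| + L))
    fun k => ?_
  rw [norm_mul, Real.norm_eq_abs, Real.norm_eq_abs, abs_of_nonneg (gaussWeight_nonneg k hy)]
  exact mul_le_mul_of_nonneg_left (hf.abs_le (gaussBranch_mem k hy)) (gaussWeight_nonneg k hy)

lemma abs_gaussBranch_sub (k : ℕ) {x y : ℝ} (hx : 0 ≤ x) (hy : 0 ≤ y) :
    |gaussBranch k x - gaussBranch k y| = |x - y| / ((k + 1 + x) * (k + 1 + y)) := by
  have h1 : (0 : ℝ) < k + 1 + x := by positivity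
  have h2 : (0 : ℝ) < k + 1 + y := by positivity
  have : gaussBranch k x - gaussBranch k y = -(x - y) / ((k + 1 + x) * (k + 1 + y)) := by
    unfold gaussBranch; field_simp; ring
  rw [this, abs_div, abs_neg, abs_of_pos (mul_pos h1 h2)]

lemma abs_gaussBranch_succ_sub_le (k : ℕ) {y : ℝ} (hy : 0 ≤ y) :
    |gaussBranch (k + 1) y - gaussBranch k y| ≤ 1 / ((k + 1) * (k + 2)) := by
  have h1 : (0 : ℝ) < k + 1 + y := by positivity
  have h2 : (0 : ℝ) < k + 2 + y := by positivity
  have h3 : (k : ℝ) + 1 + 1 + y ≠ 0 := by positivity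
  have : gaussBranch (k + 1) y - gaussBranch k y = -(1 / ((k + 1 + y) * (k + 2 + y))) := by
    unfold gaussBranch; push_cast; field_simp; ring
  rw [this, abs_neg, abs_of_nonneg (by positivity)]
  exact one_div_le_one_div_of_le (by positivity)
    (mul_le_mul (by linarith) (by linarith) (by positivity) h1.le)

lemma abs_gaussTail_sub_le (k : ℕ) {x y : ℝ} (hx : 0 ≤ x) (hy : 0 ≤ y) :
    |(1 + x) / ((k : ℝ) + 2 + x) - (1 + y) / (k + 2 + y)| ≤
      |x - y| * ((k + 1) / (k + 2) ^ 2) := by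
  have h1 : (0 : ℝ) < k + 2 + x := by positivity
  have h2 : (0 : ℝ) < k + 2 + y := by positivity
  have : (1 + x) / ((k : ℝ) + 2 + x) - (1 + y) / (k + 2 + y) =
      (x - y) * ((k + 1) / ((k + 2 + x) * (k + 2 + y))) := by
    field_simp; ring
  rw [this, abs_mul, abs_of_nonneg (a := ((k : ℝ) + 1) / _) (by positivity)]
  gcongr
  nlinarith [(k.cast_nonneg : (0 : ℝ) ≤ k), mul_nonneg hx hy]

lemma sum_gaussWeight_mul_sub_le {L : ℝ} {f : ℝ → ℝ} (hf : UnitLipschitz L f) (n : ℕ) {x y : ℝ}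
    (hx : x ∈ Set.Icc (0 : ℝ) 1) (hy : y ∈ Set.Icc (0 : ℝ) 1) :
    ∑ k ∈ Finset.range n, gaussWeight k x * |f (gaussBranch k x) - f (gaussBranch k y)| ≤
      5 / 8 * (L * |x - y|) := by
  have hL := hf.nonneg
  have hx0 := hx.1
  have hy0 := hy.1
  have key : ∀ n : ℕ,
      ∑ k ∈ Finset.range n, gaussWeight k x * |f (gaussBranch k x) - f (gaussBranch k y)| ≤
        (1 / 4 * ∑ k ∈ Finset.range n, gaussWeight k x + 3 / 8) * (L * |x - y|) := by
    intro n
    induction n with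
    | zero => simp; positivity
    | succ n ih =>
      have hb := (hf _ (gaussBranch_mem n hx0) _ (gaussBranch_mem n hy0))
      rw [abs_gaussBranch_sub n hx0 hy0] at hb
      rw [Finset.sum_range_succ, Finset.sum_range_succ]
      have hw := gaussWeight_nonneg n hx0
      rcases Nat.eq_zero_or_pos n with rfl | hn
      · have h1 : |x - y| / (((0 : ℕ) + 1 + x) * ((0 : ℕ) + 1 + y)) ≤ |x - y| := by
          apply div_le_self (abs_nonneg _)
          push_cast
          nlinarith [mul_nonneg hx0 hy0]
        have h2 : gaussWeight 0 x ≤ 1 / 2 := by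
          unfold gaussWeight
          rw [div_le_div_iff₀ (by positivity) (by norm_num)]
          push_cast
          nlinarith
        have h3 := hb.trans (mul_le_mul_of_nonneg_left h1 hL)
        have h4 := mul_le_mul_of_nonneg_left h3 hw
        have h5 : 0 ≤ L * |x - y| := by positivity
        simp only [Finset.range_zero, Finset.sum_empty, zero_add]
        nlinarith
      · have hn' : (1 : ℝ) ≤ n := by exact_mod_cast hn
        have h1 : |x - y| / ((n + 1 + x) * (n + 1 + y)) ≤ |x - y| / 4 := by
          gcongr
          nlinarith [mul_nonneg hx0 hy0]
        have h3 := hb.trans (mul_le_mul_of_nonneg_left h1 hL)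
        have h4 := mul_le_mul_of_nonneg_left h3 hw
        linarith
  refine (key n).trans ?_
  gcongr
  rw [sum_gaussWeight n hx0]
  have : 0 ≤ (1 + x) / ((n : ℝ) + 1 + x) := by positivity
  linarith

lemma abs_sum_gaussWeight_sub_mul_le {L : ℝ} {f : ℝ → ℝ} (hf : UnitLipschitz L f) (n : ℕ)
    {x y : ℝ} (hx : x ∈ Set.Icc (0 : ℝ) 1) (hy : y ∈ Set.Icc (0 : ℝ) 1) :
    |∑ k ∈ Finset.range n, (gaussWeight k x - gaussWeight k y) * f (gaussBranch k y) +
        ((1 + x) / (n + 1 + x) - (1 + y) / (n + 1 + y)) * f (gaussBranch n y)| ≤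
      1 / 4 * (L * |x - y|) := by
  have hL := hf.nonneg
  have hx0 := hx.1
  have hy0 := hy.1
  have key : |∑ k ∈ Finset.range n, (gaussWeight k x - gaussWeight k y) * f (gaussBranch k y) +
        ((1 + x) / (n + 1 + x) - (1 + y) / (n + 1 + y)) * f (gaussBranch n y)| ≤
      (1 / 4 - 1 / (2 * ((n + 1) * (n + 2)))) * (L * |x - y|) := by
    induction n with
    | zero =>
      have h1 : 1 + x ≠ 0 := by positivity
      have h2 : 1 + y ≠ 0 := by positivity
      norm_num [div_self h1, div_self h2]
    | succ n ih =>
      have hw : ∀ z : ℝ, 0 ≤ z →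
          gaussWeight n z = (1 + z) / (n + 1 + z) - (1 + z) / (n + 2 + z) := by
        intro z hz
        unfold gaussWeight
        have h1 : (n : ℝ) + 1 + z ≠ 0 := by positivity
        have h2 : (n : ℝ) + 2 + z ≠ 0 := by positivity
        field_simp
        ring
      have e : ∑ k ∈ Finset.range (n + 1),
            (gaussWeight k x - gaussWeight k y) * f (gaussBranch k y) +
          ((1 + x) / ((n + 1 : ℕ) + 1 + x) - (1 + y) / ((n + 1 : ℕ) + 1 + y)) *
            f (gaussBranch (n + 1) y) =
          (∑ k ∈ Finset.range n, (gaussWeight k x - gaussWeight k y) * f (gaussBranch k y) +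
            ((1 + x) / (n + 1 + x) - (1 + y) / (n + 1 + y)) * f (gaussBranch n y)) +
          ((1 + x) / (n + 2 + x) - (1 + y) / (n + 2 + y)) *
            (f (gaussBranch (n + 1) y) - f (gaussBranch n y)) := by
        rw [Finset.sum_range_succ, hw x hx0, hw y hy0]
        push_cast
        rw [show (n : ℝ) + 1 + 1 = n + 2 by ring]
        ring
      rw [e]
      refine (abs_add_le _ _).trans ((add_le_add_left ih _).trans ?_)
      rw [abs_mul]
      have h1 := abs_gaussTail_sub_le n hx0 hy0
      have h2 := (hf _ (gaussBranch_mem (n + 1) hy0) _ (gaussBranch_mem n hy0)).trans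
        (mul_le_mul_of_nonneg_left (abs_gaussBranch_succ_sub_le n hy0) hL)
      have h3 := mul_le_mul h1 h2 (abs_nonneg _) (by positivity)
      have h4 : |x - y| * (((n : ℝ) + 1) / (n + 2) ^ 2) * (L * (1 / ((n + 1) * (n + 2)))) =
          1 / ((n : ℝ) + 2) ^ 3 * (L * |x - y|) := by
        field_simp
      have h5 : 1 / ((n : ℝ) + 2) ^ 3 ≤
          1 / (2 * ((n + 1) * (n + 2))) - 1 / (2 * ((n + 2) * (n + 3))) := by
        have : 1 / (2 * (((n : ℝ) + 1) * (n + 2))) - 1 / (2 * ((n + 2) * (n + 3))) =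
          1 / ((n + 1) * (n + 2) * (n + 3)) := by field_simp; ring
        rw [this]
        apply one_div_le_one_div_of_le (by positivity)
        nlinarith [(n.cast_nonneg : (0 : ℝ) ≤ n)]
      have h6 : 0 ≤ L * |x - y| := by positivity
      have h7 := mul_le_mul_of_nonneg_right h5 h6
      push_cast
      rw [show (n : ℝ) + 1 + 1 = n + 2 by ring, show (n : ℝ) + 1 + 2 = n + 3 by ring]
      linarith
  refine key.trans ?_
  gcongr
  have : 0 ≤ 1 / (2 * (((n : ℝ) + 1) * (n + 2))) := by positivity
  linarith

/-- The transfer operator contracts Lipschitz constants. -/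
lemma UnitLipschitz.gaussTransfer {L : ℝ} {f : ℝ → ℝ} (hf : UnitLipschitz L f) :
    UnitLipschitz (7 / 8 * L) (gaussTransfer f) := by
  intro x hx y hy
  have hx0 := hx.1
  have hy0 := hy.1
  set Q : ℕ → ℝ := fun n => (1 + x) / (n + 1 + x) - (1 + y) / (n + 1 + y)
  have hQ : Tendsto (fun n => |Q n|) atTop (nhds 0) := by
    simpa using ((tendsto_one_add_div x).sub (tendsto_one_add_div y)).abs
  have hS : Tendsto (fun n => |∑ k ∈ Finset.range n, gaussWeight k x * f (gaussBranch k x) -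
      ∑ k ∈ Finset.range n, gaussWeight k y * f (gaussBranch k y)|) atTop
      (nhds |_root_.gaussTransfer f x - _root_.gaussTransfer f y|) :=
    ((hf.summable_gaussWeight_mul hx0).hasSum.tendsto_sum_nat.sub
      (hf.summable_gaussWeight_mul hy0).hasSum.tendsto_sum_nat).abs
  have hR : Tendsto (fun n => 7 / 8 * L * |x - y| + |Q n| * (|f 0| + L)) atTop
      (nhds (7 / 8 * L * |x - y|)) := by
    simpa using (hQ.mul_const (|f 0| + L)).const_add (7 / 8 * L * |x - y|)
  refine le_of_tendsto_of_tendsto' hS hR fun n => ?_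
  have e : ∑ k ∈ Finset.range n, gaussWeight k x * f (gaussBranch k x) -
      ∑ k ∈ Finset.range n, gaussWeight k y * f (gaussBranch k y) =
      ∑ k ∈ Finset.range n, gaussWeight k x * (f (gaussBranch k x) - f (gaussBranch k y)) +
      (∑ k ∈ Finset.range n, (gaussWeight k x - gaussWeight k y) * f (gaussBranch k y) +
        Q n * f (gaussBranch n y)) - Q n * f (gaussBranch n y) := by
    rw [← add_assoc, add_sub_cancel_right, ← Finset.sum_sub_distrib, ← Finset.sum_add_distrib]
    exact Finset.sum_congr rfl fun k _ => by ring
  have h1 : |∑ k ∈ Finset.range n,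
      gaussWeight k x * (f (gaussBranch k x) - f (gaussBranch k y))| ≤
      5 / 8 * (L * |x - y|) := by
    refine (Finset.abs_sum_le_sum_abs _ _).trans
      (le_trans (le_of_eq ?_) (sum_gaussWeight_mul_sub_le hf n hx hy))
    refine Finset.sum_congr rfl fun k _ => ?_
    rw [abs_mul, abs_of_nonneg (gaussWeight_nonneg k hx0)]
  have h2 := abs_sum_gaussWeight_sub_mul_le hf n hx hy
  have h3 : |Q n * f (gaussBranch n y)| ≤ |Q n| * (|f 0| + L) := by
    rw [abs_mul]
    exact mul_le_mul_of_nonneg_left (hf.abs_le (gaussBranch_mem n hy0)) (abs_nonneg _)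
  rw [e]
  refine (abs_sub _ _).trans ((add_le_add_left (abs_add_le _ _) _).trans ?_)
  linarith

lemma ofReal_gaussTransfer {L : ℝ} {f : ℝ → ℝ} (hf : UnitLipschitz L f)
    (h0 : ∀ x ∈ Set.Icc (0 : ℝ) 1, 0 ≤ f x) {y : ℝ} (hy : 0 ≤ y) :
    ENNReal.ofReal (gaussTransfer f y) =
      ∑' k, ENNReal.ofReal (gaussWeight k y) * ENNReal.ofReal (f (gaussBranch k y)) := by
  rw [gaussTransfer, ENNReal.ofReal_tsum_of_nonneg
    (fun k => mul_nonneg (gaussWeight_nonneg k hy) (h0 _ (gaussBranch_mem k hy)))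
    (hf.summable_gaussWeight_mul hy)]
  exact tsum_congr fun k => ENNReal.ofReal_mul (gaussWeight_nonneg k hy)

lemma lintegral_ofReal_mul_comp_gaussMap {L : ℝ} {f : ℝ → ℝ} (hf : UnitLipschitz L f)
    (h0 : ∀ x ∈ Set.Icc (0 : ℝ) 1, 0 ≤ f x) (hm : Measurable f) {g : ℝ → ENNReal}
    (hg : Measurable g) :
    ∫⁻ x, ENNReal.ofReal (f x) * g (gaussMap x) ∂gaussMeasure =
      ∫⁻ y, ENNReal.ofReal (gaussTransfer f y) * g y ∂gaussMeasure := by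
  rw [lintegral_mul_comp_gaussMap hm.ennreal_ofReal hg]
  refine lintegral_congr_ae ?_
  filter_upwards [gaussMeasure_ae_mem] with y hy
  rw [ofReal_gaussTransfer hf h0 hy.1.le]

/-- Decay of correlations for the Gauss map. -/
lemma lintegral_mul_comp_iterate_gaussMap_le {g : ℝ → ENNReal} (hg : Measurable g) (n : ℕ) :
    ∀ {L : ℝ} {f : ℝ → ℝ}, UnitLipschitz L f → (∀ x ∈ Set.Icc (0 : ℝ) 1, 0 ≤ f x) →
      Measurable f →
      ∫⁻ x, ENNReal.ofReal (f x) * g (gaussMap^[n] x) ∂gaussMeasure ≤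
        (∫⁻ x, ENNReal.ofReal (f x) ∂gaussMeasure + ENNReal.ofReal ((7 / 8) ^ n * L)) *
          ∫⁻ x, g x ∂gaussMeasure := by
  induction n with
  | zero =>
    intro L f hf h0 hm
    rw [← lintegral_const_mul _ hg]
    refine lintegral_mono_ae ?_
    filter_upwards [gaussMeasure_ae_mem] with x hx
    simp only [Function.iterate_zero, id, pow_zero, one_mul]
    gcongr
    have : ENNReal.ofReal (f x) = ∫⁻ _, ENNReal.ofReal (f x) ∂gaussMeasure := by simp
    rw [this]
    have h2 : ∫⁻ y, ENNReal.ofReal (f y) ∂gaussMeasure + ENNReal.ofReal L =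
        ∫⁻ y, (ENNReal.ofReal (f y) + ENNReal.ofReal L) ∂gaussMeasure := by
      rw [lintegral_add_right _ measurable_const]; simp
    rw [h2]
    refine lintegral_mono_ae ?_
    filter_upwards [gaussMeasure_ae_mem] with y hy
    rw [← ENNReal.ofReal_add (h0 y (Set.Ioo_subset_Icc_self hy)) hf.nonneg]
    apply ENNReal.ofReal_le_ofReal
    have h3 := le_of_abs_le (hf x (Set.Ioo_subset_Icc_self hx) y (Set.Ioo_subset_Icc_self hy))
    have h4 : |x - y| ≤ 1 := by rw [abs_le]; constructor <;> linarith [hx.1, hx.2, hy.1, hy.2]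
    have h5 := mul_le_mul_of_nonneg_left h4 hf.nonneg
    linarith
  | succ n ih =>
    intro L f hf h0 hm
    have h1 := lintegral_ofReal_mul_comp_gaussMap hf h0 hm
      (hg.comp (measurable_gaussMap.iterate n))
    have h2 := lintegral_ofReal_mul_comp_gaussMap hf h0 hm (g := fun _ => 1) measurable_const
    simp only [mul_one] at h2
    simp only [Function.comp_apply, ← Function.iterate_succ_apply] at h1
    rw [h1, h2, pow_succ, mul_assoc]
    exact ih hf.gaussTransfer (fun x hx => gaussTransfer_nonneg h0 hx.1)
      (measurable_gaussTransfer hm)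

/-- The leading digit, truncated to `0` above `N`. -/
noncomputable def truncDigit (N : ℕ) (y : ℝ) : ℝ :=
  if leadingDigit y ≤ N then leadingDigit y else 0

/-- The image of the `r`-th power of `truncDigit N` under the transfer operator. -/
noncomputable def truncWeight (r N : ℕ) (y : ℝ) : ℝ :=
  ∑ k ∈ Finset.range N, ((k : ℝ) + 1) ^ r * gaussWeight k y

/-- The Gauss mean of the truncated leading digit. -/
noncomputable def truncMean (N : ℕ) : ℝ := ∫ x, truncDigit N x ∂gaussMeasure

lemma measurable_truncDigit (N : ℕ) : Measurable (truncDigit N) :=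
  (measurable_from_top (f := fun d : ℕ => if d ≤ N then (d : ℝ) else 0)).comp
    measurable_leadingDigit

lemma truncDigit_nonneg (N : ℕ) (y : ℝ) : 0 ≤ truncDigit N y := by
  unfold truncDigit; split_ifs <;> positivity

lemma truncDigit_le (N : ℕ) (y : ℝ) : truncDigit N y ≤ N := by
  unfold truncDigit
  split_ifs with h
  · exact_mod_cast h
  · positivity

lemma truncDigit_le_leadingDigit (N : ℕ) (y : ℝ) : truncDigit N y ≤ leadingDigit y := by
  unfold truncDigit
  split_ifs with h
  · exact le_rfl
  · positivity

lemma measurable_truncWeight (r N : ℕ) : Measurable (truncWeight r N) :=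
  Finset.measurable_sum _ fun k _ => (measurable_gaussWeight k).const_mul _

lemma truncWeight_nonneg (r N : ℕ) {y : ℝ} (hy : 0 ≤ y) : 0 ≤ truncWeight r N y :=
  Finset.sum_nonneg fun k _ => mul_nonneg (by positivity) (gaussWeight_nonneg k hy)

lemma lintegral_truncDigit_pow_mul {r : ℕ} (hr : r ≠ 0) (N : ℕ) {g : ℝ → ENNReal}
    (hg : Measurable g) :
    ∫⁻ x, ENNReal.ofReal (truncDigit N x ^ r) * g (gaussMap x) ∂gaussMeasure =
      ∫⁻ y, ENNReal.ofReal (truncWeight r N y) * g y ∂gaussMeasure := by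
  rw [lintegral_mul_comp_gaussMap ((measurable_truncDigit N).pow_const r).ennreal_ofReal hg]
  refine lintegral_congr_ae ?_
  filter_upwards [gaussMeasure_ae_mem] with y hy
  congr 1
  have hd : ∀ k, truncDigit N (gaussBranch k y) = if k + 1 ≤ N then ((k : ℝ) + 1) else 0 := by
    intro k
    rw [truncDigit, leadingDigit_gaussBranch k (Set.Ioo_subset_Ico_self hy)]
    push_cast; rfl
  rw [tsum_eq_sum (s := Finset.range N), truncWeight, ENNReal.ofReal_sum_of_nonneg]
  · refine Finset.sum_congr rfl fun k hk => ?_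
    rw [hd, if_pos (Nat.succ_le_iff.2 (Finset.mem_range.1 hk)), ← ENNReal.ofReal_mul (gaussWeight_nonneg k hy.1.le),
      mul_comm]
  · exact fun k _ => mul_nonneg (by positivity) (gaussWeight_nonneg k hy.1.le)
  · intro k hk
    rw [hd, if_neg (by simpa using hk)]
    simp [hr]

lemma integrable_of_bounded {Ω : Type*} [MeasurableSpace Ω] {μ : Measure Ω} [IsFiniteMeasure μ]
    {X : Ω → ℝ} (hX : Measurable X) {B : ℝ} (hB : ∀ x, |X x| ≤ B) : Integrable X μ :=
  Integrable.of_bound hX.aestronglyMeasurable B (Eventually.of_forall hB)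

lemma abs_truncDigit_le (N : ℕ) (y : ℝ) : |truncDigit N y| ≤ N := by
  rw [abs_of_nonneg (truncDigit_nonneg N y)]; exact truncDigit_le N y

lemma integrable_truncDigit_pow (r N : ℕ) :
    Integrable (fun x => truncDigit N x ^ r) gaussMeasure :=
  integrable_of_bounded ((measurable_truncDigit N).pow_const r) (B := (N : ℝ) ^ r) fun x => by
    rw [abs_pow]; exact pow_le_pow_left₀ (abs_nonneg _) (abs_truncDigit_le N x) r

lemma integrable_truncDigit (N : ℕ) : Integrable (truncDigit N) gaussMeasure := by
  simpa using integrable_truncDigit_pow 1 N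

lemma truncMean_nonneg (N : ℕ) : 0 ≤ truncMean N := integral_nonneg (truncDigit_nonneg N)

lemma ofReal_truncMean (N : ℕ) :
    ENNReal.ofReal (truncMean N) = ∫⁻ x, ENNReal.ofReal (truncDigit N x) ∂gaussMeasure :=
  ofReal_integral_eq_lintegral_ofReal (integrable_truncDigit N)
    (Eventually.of_forall (truncDigit_nonneg N))

lemma ofReal_integral_truncDigit_pow {r : ℕ} (hr : r ≠ 0) (N : ℕ) :
    ENNReal.ofReal (∫ x, truncDigit N x ^ r ∂gaussMeasure) =
      ∫⁻ y in Set.Ioo (0 : ℝ) 1,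
        ENNReal.ofReal (1 / (log 2 * (1 + y)) * truncWeight r N y) := by
  have hl := log_pos one_lt_two
  have h := lintegral_truncDigit_pow_mul hr N (g := fun _ => 1) measurable_const
  simp only [mul_one] at h
  rw [ofReal_integral_eq_lintegral_ofReal (integrable_truncDigit_pow r N)
    (Eventually.of_forall fun x => pow_nonneg (truncDigit_nonneg N x) r), h,
    lintegral_gaussMeasure (measurable_truncWeight r N).ennreal_ofReal]
  refine setLIntegral_congr_fun measurableSet_Ioo fun y hy => ?_
  have := hy.1
  exact (ENNReal.ofReal_mul (by positivity)).symm

lemma truncWeight_density_eq (r N : ℕ) {y : ℝ} (hy : 0 ≤ y) :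
    1 / (log 2 * (1 + y)) * truncWeight r N y =
      (∑ k ∈ Finset.range N, ((k : ℝ) + 1) ^ r / ((k + 1 + y) * (k + 2 + y))) / log 2 := by
  have hl := log_pos one_lt_two
  rw [truncWeight, Finset.mul_sum, Finset.sum_div]
  refine Finset.sum_congr rfl fun k _ => ?_
  unfold gaussWeight
  have : 0 < (k : ℝ) + 1 + y := by positivity
  have : 0 < (k : ℝ) + 2 + y := by positivity
  field_simp

lemma integral_truncDigit_pow_le {r : ℕ} (hr : r ≠ 0) (N : ℕ) {B : ℝ} (hB0 : 0 ≤ B)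
    (hB : ∀ y ∈ Set.Ioo (0 : ℝ) 1,
      ∑ k ∈ Finset.range N, ((k : ℝ) + 1) ^ r / ((k + 1 + y) * (k + 2 + y)) ≤ B) :
    ∫ x, truncDigit N x ^ r ∂gaussMeasure ≤ B / log 2 := by
  have hl := log_pos one_lt_two
  rw [← ENNReal.ofReal_le_ofReal_iff (by positivity), ofReal_integral_truncDigit_pow hr]
  refine (setLIntegral_mono (g := fun _ => ENNReal.ofReal (B / log 2)) measurable_const
    fun y hy => ?_).trans (by simp)
  apply ENNReal.ofReal_le_ofReal
  rw [truncWeight_density_eq r N hy.1.le]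
  gcongr
  exact hB y hy

lemma le_integral_truncDigit_pow {r : ℕ} (hr : r ≠ 0) (N : ℕ) {A : ℝ}
    (hA : ∀ y ∈ Set.Ioo (0 : ℝ) 1,
      A ≤ ∑ k ∈ Finset.range N, ((k : ℝ) + 1) ^ r / ((k + 1 + y) * (k + 2 + y))) :
    A / log 2 ≤ ∫ x, truncDigit N x ^ r ∂gaussMeasure := by
  have hl := log_pos one_lt_two
  rw [← ENNReal.ofReal_le_ofReal_iff (integral_nonneg fun x => pow_nonneg (truncDigit_nonneg N x) r),
    ofReal_integral_truncDigit_pow hr]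
  refine le_trans (by simp) (setLIntegral_mono (f := fun _ => ENNReal.ofReal (A / log 2))
    ?_ fun y hy => ?_)
  · exact (Measurable.mul (by fun_prop) (measurable_truncWeight r N)).ennreal_ofReal
  apply ENNReal.ofReal_le_ofReal
  rw [truncWeight_density_eq r N hy.1.le]
  gcongr
  exact hA y hy

lemma sum_one_div_succ_le (N : ℕ) : ∑ k ∈ Finset.range N, 1 / ((k : ℝ) + 1) ≤ 1 + log N := by
  refine le_trans (le_of_eq ?_) (harmonic_le_one_add_log N)
  simp [harmonic]

lemma log_le_sum_one_div_succ (N : ℕ) : log N ≤ ∑ k ∈ Finset.range N, 1 / ((k : ℝ) + 1) := by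
  have h : log N ≤ log (N + 1 : ℕ) := by
    rcases Nat.eq_zero_or_pos N with rfl | hN
    · simp
    · exact log_le_log (by exact_mod_cast hN) (by push_cast; linarith)
  refine h.trans ((log_add_one_le_harmonic N).trans (le_of_eq ?_))
  simp [harmonic]

lemma truncMean_le (N : ℕ) : truncMean N ≤ (1 + log N) / log 2 := by
  have h := integral_truncDigit_pow_le one_ne_zero N (B := 1 + log N)
    (by have := log_natCast_nonneg N; linarith) fun y hy => ?_
  · simpa [truncMean] using h
  refine le_trans (Finset.sum_le_sum fun k _ => ?_) (sum_one_div_succ_le N)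
  have hy0 := hy.1.le
  rw [pow_one, div_le_div_iff₀ (by positivity) (by positivity)]
  nlinarith [(k.cast_nonneg : (0 : ℝ) ≤ k), mul_nonneg hy0 hy0,
    mul_nonneg hy0 (k.cast_nonneg : (0 : ℝ) ≤ k)]

lemma le_truncMean (N : ℕ) : (log N - 3) / log 2 ≤ truncMean N := by
  have h := le_integral_truncDigit_pow one_ne_zero N (A := log N - 3) fun y hy => ?_
  · simpa [truncMean] using h
  have hs : ∀ M : ℕ, ∑ k ∈ Finset.range M, 3 / (((k : ℝ) + 1) * (k + 2)) = 3 - 3 / (M + 1) := by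
    intro M
    induction M with
    | zero => simp
    | succ M ih => rw [Finset.sum_range_succ, ih]; push_cast; field_simp; ring
  have h3 : (0 : ℝ) ≤ 3 / (N + 1) := by positivity
  have h4 : ∑ k ∈ Finset.range N, (1 / ((k : ℝ) + 1) - 3 / (((k : ℝ) + 1) * (k + 2))) ≤
      ∑ k ∈ Finset.range N, ((k : ℝ) + 1) ^ 1 / ((k + 1 + y) * (k + 2 + y)) := by
    refine Finset.sum_le_sum fun k _ => ?_
    have hk : (0 : ℝ) ≤ k := k.cast_nonneg
    have hy0 := hy.1.le
    have hy1 := hy.2.le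
    calc 1 / ((k : ℝ) + 1) - 3 / (((k : ℝ) + 1) * (k + 2))
        ≤ ((k : ℝ) + 1) ^ 1 / ((k + 2) * (k + 3)) := by
          have : ((k : ℝ) + 1) ^ 1 / ((k + 2) * (k + 3)) -
              (1 / ((k : ℝ) + 1) - 3 / (((k : ℝ) + 1) * (k + 2))) =
              4 / ((k + 1) * (k + 2) * (k + 3)) := by field_simp; ring
          have h5 : 0 ≤ 4 / (((k : ℝ) + 1) * (k + 2) * (k + 3)) := by positivity
          linarith
      _ ≤ _ := by
          refine div_le_div_of_nonneg_left (by positivity) (by positivity) ?_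
          exact mul_le_mul (by linarith) (by linarith) (by positivity) (by positivity)
  rw [Finset.sum_sub_distrib, hs] at h4
  linarith [log_le_sum_one_div_succ N]

lemma integral_truncDigit_sq_le (N : ℕ) : ∫ x, truncDigit N x ^ 2 ∂gaussMeasure ≤ 2 * N := by
  have hl := log_two_gt_d9
  refine (integral_truncDigit_pow_le two_ne_zero N (B := N) N.cast_nonneg fun y hy => ?_).trans ?_
  · refine (Finset.sum_le_card_nsmul _ _ 1 fun k _ => ?_).trans (by simp)
    have hy0 := hy.1.le
    rw [div_le_one (by positivity)]
    nlinarith [(k.cast_nonneg : (0 : ℝ) ≤ k), mul_nonneg hy0 hy0,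
      mul_nonneg hy0 (k.cast_nonneg : (0 : ℝ) ≤ k)]
  · rw [div_le_iff₀ (by linarith)]
    nlinarith [(N.cast_nonneg : (0 : ℝ) ≤ N)]

lemma unitLipschitz_gaussWeight (k : ℕ) :
    UnitLipschitz (2 / ((k + 1) * (k + 2))) (gaussWeight k) := by
  intro x hx y hy
  have hk : (0 : ℝ) ≤ k := k.cast_nonneg
  obtain ⟨hx0, hx1⟩ := hx
  obtain ⟨hy0, hy1⟩ := hy
  have hxy := mul_nonneg hx0 hy0
  have hxy1 : x * y ≤ 1 := mul_le_one₀ hx1 hy0 hy1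
  have e : gaussWeight k x - gaussWeight k y =
      ((k : ℝ) ^ 2 + k - 1 - x - y - x * y) /
        ((k + 1 + x) * (k + 2 + x) * ((k + 1 + y) * (k + 2 + y))) * (x - y) := by
    unfold gaussWeight
    have h1 : (k : ℝ) + 1 + x ≠ 0 := by positivity
    have h2 : (k : ℝ) + 2 + x ≠ 0 := by positivity
    have h3 : (k : ℝ) + 1 + y ≠ 0 := by positivity
    have h4 : (k : ℝ) + 2 + y ≠ 0 := by positivity
    field_simp
    ring
  rw [e, abs_mul, abs_div]
  refine mul_le_mul_of_nonneg_right ?_ (abs_nonneg _)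
  rw [abs_of_pos (a := ((k : ℝ) + 1 + x) * _ * _) (by positivity)]
  calc _ ≤ 2 * (((k : ℝ) + 1) * (k + 2)) / ((k + 1) * (k + 2) * ((k + 1) * (k + 2))) := by
        refine div_le_div₀ (by positivity) ?_ (by positivity) ?_
        · rw [abs_le]; constructor <;> nlinarith
        · refine mul_le_mul ?_ ?_ (by positivity) (by positivity) <;>
            exact mul_le_mul (by linarith) (by linarith) (by positivity) (by positivity)
    _ = _ := by field_simp

lemma unitLipschitz_truncWeight (N : ℕ) : UnitLipschitz (2 * (1 + log N)) (truncWeight 1 N) := by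
  intro x hx y hy
  have h : |truncWeight 1 N x - truncWeight 1 N y| ≤
      ∑ k ∈ Finset.range N, 2 * (1 / ((k : ℝ) + 1)) * |x - y| := by
    rw [truncWeight, truncWeight, ← Finset.sum_sub_distrib]
    refine (Finset.abs_sum_le_sum_abs _ _).trans (Finset.sum_le_sum fun k _ => ?_)
    have hk : (0 : ℝ) ≤ k := k.cast_nonneg
    rw [← mul_sub, abs_mul, pow_one, abs_of_nonneg (by positivity)]
    refine (mul_le_mul_of_nonneg_left (unitLipschitz_gaussWeight k x hx y hy)
      (by positivity)).trans ?_
    rw [← mul_assoc]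
    refine mul_le_mul_of_nonneg_right ?_ (abs_nonneg _)
    have : ((k : ℝ) + 1) * (2 / ((k + 1) * (k + 2))) = 2 * (1 / (k + 2)) := by field_simp
    rw [this]
    gcongr
    norm_num
  rw [← Finset.sum_mul, ← Finset.mul_sum] at h
  refine h.trans ?_
  gcongr
  exact sum_one_div_succ_le N

/-- Correlation bound for truncated leading digits. -/
lemma integral_truncDigit_mul_iterate_le (N d : ℕ) :
    ∫ x, truncDigit N x * truncDigit N (gaussMap^[d + 1] x) ∂gaussMeasure ≤
      truncMean N ^ 2 + (7 / 8) ^ d * (2 * (1 + log N) * truncMean N) := by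
  have hlog := log_natCast_nonneg N
  have hm := truncMean_nonneg N
  have hT := measurable_truncDigit N
  have hTd : Measurable fun x => truncDigit N (gaussMap^[d + 1] x) :=
    hT.comp (measurable_gaussMap.iterate _)
  have hi : Integrable (fun x => truncDigit N x * truncDigit N (gaussMap^[d + 1] x))
      gaussMeasure :=
    integrable_of_bounded (hT.mul hTd) (B := N * N) fun x => by
      rw [abs_mul]
      exact mul_le_mul (abs_truncDigit_le N _) (abs_truncDigit_le N _) (abs_nonneg _)
        N.cast_nonneg
  rw [← ENNReal.ofReal_le_ofReal_iff (by positivity), ofReal_integral_eq_lintegral_ofReal hi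
    (Eventually.of_forall fun x => mul_nonneg (truncDigit_nonneg N _) (truncDigit_nonneg N _))]
  have hg : Measurable fun x => ENNReal.ofReal (truncDigit N (gaussMap^[d] x)) :=
    (hT.comp (measurable_gaussMap.iterate _)).ennreal_ofReal
  have h1 := lintegral_truncDigit_pow_mul one_ne_zero N hg
  have h2 := lintegral_truncDigit_pow_mul one_ne_zero N (g := fun _ => 1) measurable_const
  simp only [pow_one, mul_one] at h1 h2
  calc _ = ∫⁻ x, ENNReal.ofReal (truncDigit N x) *
        ENNReal.ofReal (truncDigit N (gaussMap^[d] (gaussMap x))) ∂gaussMeasure := by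
        refine lintegral_congr fun x => ?_
        rw [ENNReal.ofReal_mul (truncDigit_nonneg N _), Function.iterate_succ_apply]
    _ ≤ _ := h1.le.trans (lintegral_mul_comp_iterate_gaussMap_le hT.ennreal_ofReal d
        (unitLipschitz_truncWeight N) (fun x hx => truncWeight_nonneg 1 N hx.1)
        (measurable_truncWeight 1 N))
    _ = _ := by
        rw [← h2, ← ofReal_truncMean, ← ENNReal.ofReal_add hm (by positivity),
          ← ENNReal.ofReal_mul (by positivity)]
        congr 1
        ring

/-- A second moment bound for sums of exponentially decorrelated variables. -/
lemma integral_sq_sum_sub_le {Ω : Type*} [MeasurableSpace Ω] {μ : Measure Ω}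
    [IsProbabilityMeasure μ] {X : ℕ → Ω → ℝ} (hX : ∀ i, Measurable (X i)) {B : ℝ}
    (hB : ∀ i x, |X i x| ≤ B) {m V K : ℝ} (hK : 0 ≤ K) (hm : ∀ i, ∫ x, X i x ∂μ = m)
    (hV : ∀ i, ∫ x, X i x ^ 2 ∂μ ≤ V)
    (hC : ∀ i j, i < j → ∫ x, X i x * X j x ∂μ ≤ m ^ 2 + (7 / 8) ^ (j - i) * K) (n : ℕ) :
    Integrable (fun x => (∑ i ∈ Finset.range n, X i x - n * m) ^ 2) μ ∧
      ∫ x, (∑ i ∈ Finset.range n, X i x - n * m) ^ 2 ∂μ ≤ n * (V + 14 * K) := by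
  have hint : ∀ i, Integrable (X i) μ := fun i => integrable_of_bounded (hX i) (hB i)
  have hint2 : ∀ i j, Integrable (fun x => X i x * X j x) μ := fun i j =>
    integrable_of_bounded ((hX i).mul (hX j)) (B := B * B) fun x => by
      rw [abs_mul]
      exact mul_le_mul (hB i x) (hB j x) (abs_nonneg _) ((abs_nonneg _).trans (hB i x))
  have hcov : ∀ i j, Integrable (fun x => (X i x - m) * (X j x - m)) μ ∧
      ∫ x, (X i x - m) * (X j x - m) ∂μ = ∫ x, X i x * X j x ∂μ - m ^ 2 := by
    intro i j
    have e : (fun x => (X i x - m) * (X j x - m)) =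
        fun x => (X i x * X j x - m * X i x) - (m * X j x - m ^ 2) := by
      ext x; ring
    have i1 : Integrable (fun x => X i x * X j x - m * X i x) μ :=
      (hint2 i j).sub ((hint i).const_mul m)
    have i2 : Integrable (fun x => m * X j x - m ^ 2) μ :=
      ((hint j).const_mul m).sub (integrable_const (m ^ 2))
    rw [e]
    refine ⟨i1.sub i2, ?_⟩
    rw [integral_sub i1 i2, integral_sub (hint2 i j) ((hint i).const_mul m),
      integral_sub ((hint j).const_mul m) (integrable_const _), integral_const_mul,
      integral_const_mul, hm, hm]
    simp
    ring
  have hgeo : ∀ n : ℕ, ∑ i ∈ Finset.range n, (7 / 8 : ℝ) ^ (n - i) ≤ 7 := by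
    intro n
    have : ∑ i ∈ Finset.range n, (7 / 8 : ℝ) ^ (n - i) = 7 - 7 * (7 / 8) ^ n := by
      induction n with
      | zero => simp
      | succ n ih =>
        rw [Finset.sum_range_succ]
        have : ∑ i ∈ Finset.range n, (7 / 8 : ℝ) ^ (n + 1 - i) =
            7 / 8 * ∑ i ∈ Finset.range n, (7 / 8 : ℝ) ^ (n - i) := by
          rw [Finset.mul_sum]
          refine Finset.sum_congr rfl fun i hi => ?_
          rw [Nat.succ_sub (Finset.mem_range.1 hi).le, pow_succ, mul_comm]
        rw [this, ih]
        simp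
        ring
    rw [this]
    have : (0 : ℝ) ≤ (7 / 8) ^ n := by positivity
    linarith
  have hsum : ∀ n : ℕ, ∀ x, ∑ i ∈ Finset.range n, X i x - n * m =
      ∑ i ∈ Finset.range n, (X i x - m) := fun n x => by simp
  simp_rw [hsum]
  induction n with
  | zero => simp
  | succ n ih =>
    have i1 : Integrable (fun x => ∑ i ∈ Finset.range n, (X i x - m) * (X n x - m)) μ :=
      integrable_finsetSum _ fun i _ => (hcov i n).1
    have e : (fun x => (∑ i ∈ Finset.range (n + 1), (X i x - m)) ^ 2) = fun x =>
        ((∑ i ∈ Finset.range n, (X i x - m)) ^ 2 +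
          2 * ∑ i ∈ Finset.range n, (X i x - m) * (X n x - m)) +
          (X n x - m) * (X n x - m) := by
      ext x
      rw [Finset.sum_range_succ, ← Finset.sum_mul]
      ring
    have i2 : Integrable (fun x => (∑ i ∈ Finset.range n, (X i x - m)) ^ 2 +
        2 * ∑ i ∈ Finset.range n, (X i x - m) * (X n x - m)) μ := ih.1.add (i1.const_mul 2)
    rw [e]
    refine ⟨i2.add (hcov n n).1, ?_⟩
    rw [integral_add i2 (hcov n n).1, integral_add ih.1 (i1.const_mul 2), integral_const_mul,
      integral_finsetSum _ fun i _ => (hcov i n).1, (hcov n n).2]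
    have h1 : ∑ i ∈ Finset.range n, ∫ x, (X i x - m) * (X n x - m) ∂μ ≤ 7 * K := by
      refine (Finset.sum_le_sum (g := fun i => (7 / 8 : ℝ) ^ (n - i) * K) fun i hi => ?_).trans ?_
      · rw [(hcov i n).2]
        linarith [hC i n (Finset.mem_range.1 hi)]
      · rw [← Finset.sum_mul]
        exact mul_le_mul_of_nonneg_right (hgeo n) hK
    have h2 : ∫ x, X n x * X n x ∂μ ≤ V := by simpa only [sq] using hV n
    have h3 := ih.2
    push_cast
    nlinarith [sq_nonneg m]

/-- Second moment bound for the sums of truncated odd-indexed digits. -/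
lemma integral_sq_sum_truncDigit_sub_le {N : ℕ} (hN : N ≠ 0) (n : ℕ) :
    Integrable (fun x => (∑ i ∈ Finset.range n, truncDigit N (gaussMap^[2 * i] x) -
        n * truncMean N) ^ 2) gaussMeasure ∧
      ∫ x, (∑ i ∈ Finset.range n, truncDigit N (gaussMap^[2 * i] x) - n * truncMean N) ^ 2
        ∂gaussMeasure ≤ n * (226 * N) := by
  have hlog := log_natCast_nonneg N
  have hm := truncMean_nonneg N
  have hT := measurable_truncDigit N
  have hmp := fun i => measurePreserving_gaussMap.iterate (2 * i)
  have hcomp : ∀ i, ∀ F : ℝ → ℝ, Measurable F →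
      ∫ x, F (gaussMap^[2 * i] x) ∂gaussMeasure = ∫ x, F x ∂gaussMeasure := by
    intro i F hF
    have h := (integral_map (μ := gaussMeasure) (hmp i).measurable.aemeasurable
      (f := F) hF.aestronglyMeasurable)
    rw [(hmp i).map_eq] at h
    exact h.symm
  have hl := log_two_gt_d9
  have hK : 2 * (1 + log N) * truncMean N ≤ 16 * N := by
    have h1 := truncMean_le N
    have h2 : (1 + log N) / log 2 ≤ 2 * (1 + log N) := by
      rw [div_le_iff₀ (by linarith)]; nlinarith
    have hN1 : (1 : ℝ) ≤ N := by exact_mod_cast Nat.one_le_iff_ne_zero.2 hN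
    have hs : 0 < √(N : ℝ) := sqrt_pos.2 (by linarith)
    have h3 : 1 + log N ≤ 2 * √N := by
      have := log_le_sub_one_of_pos hs
      rw [log_sqrt (by linarith)] at this
      linarith
    have h4 : (1 + log N) ^ 2 ≤ (2 * √N) ^ 2 := pow_le_pow_left₀ (by linarith) h3 2
    rw [mul_pow, sq_sqrt (by linarith)] at h4
    have h5 : 2 * (1 + log N) * truncMean N ≤ 2 * (1 + log N) * (2 * (1 + log N)) := by
      gcongr
      exact h1.trans h2
    nlinarith
  refine (integral_sq_sum_sub_le (μ := gaussMeasure) (fun i => hT.comp (hmp i).measurable)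
    (fun i x => abs_truncDigit_le N _) (m := truncMean N) (V := 2 * N)
    (K := 2 * (1 + log N) * truncMean N) (by positivity) (fun i => hcomp i _ hT) (fun i => ?_)
    (fun i j hij => ?_) n).imp_right fun h => h.trans ?_
  · exact (hcomp i _ (hT.pow_const 2)).le.trans (integral_truncDigit_sq_le N)
  · obtain ⟨d, rfl⟩ := Nat.exists_eq_add_of_lt hij
    have h1 := hcomp i (fun x => truncDigit N x * truncDigit N (gaussMap^[2 * d + 1 + 1] x))
      (hT.mul (hT.comp (measurable_gaussMap.iterate _)))
    have h2 := integral_truncDigit_mul_iterate_le N (2 * d + 1)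
    simp only [← Function.iterate_add_apply] at h1
    have e : 2 * (i + d + 1) = 2 * d + 1 + 1 + 2 * i := by ring
    rw [show i + d + 1 - i = d + 1 by omega]
    simp only [Function.comp_apply, e]
    rw [h1]
    refine h2.trans ?_
    gcongr (_ + ?_ * _)
    exact pow_le_pow_of_le_one (by norm_num) (by norm_num) (by omega)
  · gcongr
    linarith

/-- The sum of the first `k` odd-indexed digits. -/
noncomputable def oddDigitSum (k : ℕ) (x : ℝ) : ℝ :=
  ∑ i ∈ Finset.range k, (leadingDigit (gaussMap^[2 * i] x) : ℝ)

/-- The sum of the first `k` odd-indexed digits, each truncated at `N`. -/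
noncomputable def truncOddDigitSum (N k : ℕ) (x : ℝ) : ℝ :=
  ∑ i ∈ Finset.range k, truncDigit N (gaussMap^[2 * i] x)

lemma sum_rcfDigit_eq_oddDigitSum (k : ℕ) (x : ℝ) :
    ∑ i ∈ Finset.Icc 1 k, (rcfDigit x (2 * i - 1) : ℝ) = oddDigitSum k x := by
  rw [oddDigitSum]
  induction k with
  | zero => simp
  | succ k ih =>
    rw [Finset.sum_Icc_succ_top (by omega), ih, Finset.sum_range_succ, rcfDigit, leadingDigit,
      show 2 * (k + 1) - 1 - 1 = 2 * k by omega]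

lemma oddDigitSum_mono (x : ℝ) : Monotone fun k => oddDigitSum k x :=
  monotone_nat_of_le_succ fun k => by
    simp only [oddDigitSum, Finset.sum_range_succ]
    exact le_add_of_nonneg_right (Nat.cast_nonneg _)

lemma truncOddDigitSum_le (N k : ℕ) (x : ℝ) : truncOddDigitSum N k x ≤ oddDigitSum k x :=
  Finset.sum_le_sum fun _ _ => truncDigit_le_leadingDigit N _

lemma measurable_truncOddDigitSum (N k : ℕ) : Measurable (truncOddDigitSum N k) :=
  Finset.measurable_sum _ fun i _ =>
    (measurable_truncDigit N).comp (measurable_gaussMap.iterate (2 * i))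

lemma summable_div_succ_sq (c : ℝ) : Summable fun j : ℕ => c / ((j : ℝ) + 1) ^ 2 := by
  have h := (summable_nat_add_iff 1).2 (summable_one_div_nat_pow.2 one_lt_two)
  refine (h.mul_left c).congr fun j => ?_
  push_cast
  ring

lemma ae_eventually_le_oddDigitSum (q : ℕ) :
    ∀ᵐ x ∂gaussMeasure, ∀ᶠ j : ℕ in atTop,
      ((j : ℝ) + 1) ^ (q + 2) * (truncMean ((j + 1) ^ q) - 1) ≤
        oddDigitSum ((j + 1) ^ (q + 2)) x := by
  set n : ℕ → ℕ := fun j => (j + 1) ^ (q + 2)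
  set N : ℕ → ℕ := fun j => (j + 1) ^ q
  set s : ℕ → Set ℝ := fun j =>
    {x | (n j : ℝ) ^ 2 ≤ (truncOddDigitSum (N j) (n j) x - n j * truncMean (N j)) ^ 2}
  have hs : ∀ j, gaussMeasure (s j) ≤ ENNReal.ofReal (226 / ((j : ℝ) + 1) ^ 2) := by
    intro j
    obtain ⟨hi, hle⟩ := integral_sq_sum_truncDigit_sub_le (N := N j) (by positivity) (n j)
    have h := (mul_meas_ge_le_integral_of_nonneg
      (Eventually.of_forall fun x => sq_nonneg _) hi ((n j : ℝ) ^ 2)).trans hle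
    rw [← ofReal_measureReal]
    apply ENNReal.ofReal_le_ofReal
    have hn : (n j : ℝ) = (j + 1) ^ 2 * N j := by simp only [n, N]; push_cast; ring
    have hN : (0 : ℝ) < N j := by simp only [N]; positivity
    have hj : (0 : ℝ) < ((j : ℝ) + 1) ^ 2 := by positivity
    change (n j : ℝ) ^ 2 * gaussMeasure.real (s j) ≤ _ at h
    rw [le_div_iff₀ hj]
    refine le_of_mul_le_mul_left (a := (j + 1) ^ 2 * (N j : ℝ) ^ 2) ?_ (by positivity)
    rw [hn] at h
    linarith
  have hsum : ∑' j, gaussMeasure (s j) ≠ ⊤ :=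
    ne_top_of_le_ne_top (summable_div_succ_sq 226).tsum_ofReal_ne_top (ENNReal.tsum_le_tsum hs)
  filter_upwards [ae_eventually_notMem hsum] with x hx
  filter_upwards [hx] with j hj
  have hj' : (truncOddDigitSum (N j) (n j) x - n j * truncMean (N j)) ^ 2 < (n j : ℝ) ^ 2 :=
    not_le.1 hj
  have h1 := abs_lt_of_sq_lt_sq hj' (Nat.cast_nonneg _)
  have h2 := truncOddDigitSum_le (N j) (n j) x
  have h3 := (abs_lt.1 h1).1
  have hn : ((j : ℝ) + 1) ^ (q + 2) = n j := by simp only [n]; push_cast; rfl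
  rw [hn]
  change (n j : ℝ) * (truncMean (N j) - 1) ≤ oddDigitSum (n j) x
  linarith

lemma tendsto_succ_div_add_two :
    Tendsto (fun j : ℕ => ((j : ℝ) + 1) / (j + 2)) atTop (nhds 1) := by
  refine ((tendsto_natCast_div_add_atTop (1 : ℝ)).comp (tendsto_add_atTop_nat 1)).congr
    fun j => ?_
  simp only [Function.comp_apply]
  push_cast
  ring

lemma tendsto_log_add (a : ℝ) : Tendsto (fun j : ℕ => log ((j : ℝ) + a)) atTop atTop :=
  tendsto_log_atTop.comp (tendsto_atTop_add_const_right _ _ tendsto_natCast_atTop_atTop)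

lemma tendsto_log_succ_div_log_add_two :
    Tendsto (fun j : ℕ => log ((j : ℝ) + 1) / log (j + 2)) atTop (nhds 1) := by
  have h1 : Tendsto (fun j : ℕ => log (((j : ℝ) + 1) / (j + 2))) atTop (nhds 0) := by
    simpa using tendsto_succ_div_add_two.log one_ne_zero
  have h2 := (h1.mul (tendsto_inv_atTop_zero.comp (tendsto_log_add 2))).const_add 1
  simp only [mul_zero, add_zero] at h2
  refine h2.congr fun j => ?_
  have hl : 0 < log ((j : ℝ) + 2) := log_pos (by linarith [(j.cast_nonneg : (0 : ℝ) ≤ j)])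
  simp only [Function.comp_apply]
  rw [log_div (by positivity) (by positivity)]
  field_simp
  ring

lemma eventually_lt_of_le_on_powers {S : ℕ → ℝ} (hS : Monotone S) {q : ℕ} {c : ℝ}
    (hc : c < q / ((q + 2) * log 2)) (hq : q ≠ 0)
    (h : ∀ᶠ j : ℕ in atTop,
      ((j : ℝ) + 1) ^ (q + 2) * (truncMean ((j + 1) ^ q) - 1) ≤ S ((j + 1) ^ (q + 2))) :
    ∀ᶠ k : ℕ in atTop, c < 1 / (k * log k) * S k := by
  have hl := log_pos one_lt_two
  have hq0 : (0 : ℝ) < q := by exact_mod_cast Nat.pos_of_ne_zero hq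
  set w : ℕ → ℝ := fun j => (((j : ℝ) + 1) / (j + 2)) ^ (q + 2) *
    (((q * log (j + 1) - 3) / log 2 - 1) / ((q + 2) * log (j + 2)))
  have hw : Tendsto w atTop (nhds (q / ((q + 2) * log 2))) := by
    have h1 := (tendsto_log_succ_div_log_add_two.const_mul ((q : ℝ) / ((q + 2) * log 2))).sub
      ((tendsto_inv_atTop_zero.comp (tendsto_log_add 2)).const_mul ((3 / log 2 + 1) / (q + 2)))
    have h2 := (tendsto_succ_div_add_two.pow (q + 2)).mul h1
    simp only [one_pow, mul_one, one_mul, mul_zero, sub_zero] at h2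
    refine h2.congr fun j => ?_
    have hl : 0 < log ((j : ℝ) + 2) := log_pos (by linarith [(j.cast_nonneg : (0 : ℝ) ≤ j)])
    simp only [w, Function.comp_apply]
    congr 1
    field_simp
    ring
  have hpos : ∀ᶠ j : ℕ in atTop, (3 + log 2) / q ≤ log ((j : ℝ) + 1) :=
    (tendsto_log_add 1).eventually_ge_atTop _
  obtain ⟨J, hJ⟩ := eventually_atTop.1 ((h.and hpos).and (hw.eventually_const_lt hc))
  filter_upwards [eventually_ge_atTop ((J + 1) ^ (q + 2)), eventually_ge_atTop 2] with k hk hk2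
  have hle := Nat.pow_nthRoot_le (n := q + 2) (a := k) (Or.inl (by omega))
  have hlt := Nat.lt_pow_nthRoot_add_one (n := q + 2) (by omega) k
  have hJr : J < Nat.nthRoot (q + 2) k := by
    have := lt_of_pow_lt_pow_left₀ (q + 2) (by omega) (hk.trans_lt hlt)
    omega
  obtain ⟨j, hj⟩ : ∃ j, Nat.nthRoot (q + 2) k = j + 1 := ⟨_, (Nat.sub_add_cancel (by omega)).symm⟩
  rw [hj] at hle hlt hJr
  obtain ⟨⟨h1, h2⟩, h3⟩ := hJ j (by omega)
  refine h3.trans_le ?_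
  have hk2' : (2 : ℝ) ≤ k := by exact_mod_cast hk2
  have hk0 : (0 : ℝ) < k := by linarith
  have hlk : 0 < log (k : ℝ) := log_pos (by linarith)
  have hkle : (k : ℝ) ≤ ((j : ℝ) + 2) ^ (q + 2) := by exact_mod_cast hlt.le
  have hlogk : log (k : ℝ) ≤ (q + 2) * log ((j : ℝ) + 2) := by
    refine (log_le_log hk0 hkle).trans (le_of_eq ?_)
    rw [log_pow]; push_cast; ring
  have hm : ((q : ℝ) * log (j + 1) - 3) / log 2 - 1 ≤ truncMean ((j + 1) ^ q) - 1 := by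
    have := le_truncMean ((j + 1) ^ q)
    push_cast at this
    rw [log_pow] at this
    linarith
  have hm0 : 0 ≤ ((q : ℝ) * log (j + 1) - 3) / log 2 - 1 := by
    rw [div_le_iff₀ hq0] at h2
    rw [sub_nonneg, le_div_iff₀ hl]
    linarith
  have hSk : ((j : ℝ) + 1) ^ (q + 2) * (((q : ℝ) * log (j + 1) - 3) / log 2 - 1) ≤ S k :=
    (mul_le_mul_of_nonneg_left hm (by positivity)).trans (h1.trans (hS hle))
  calc w j = ((j : ℝ) + 1) ^ (q + 2) * (((q : ℝ) * log (j + 1) - 3) / log 2 - 1) /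
        (((j : ℝ) + 2) ^ (q + 2) * ((q + 2) * log ((j : ℝ) + 2))) := by
        simp only [w]; rw [div_pow, div_mul_div_comm]
    _ ≤ S k / (k * log k) := by
        refine div_le_div₀ (le_trans (by positivity) hSk) hSk (by positivity) ?_
        exact mul_le_mul hkle hlogk hlk.le (by positivity)
    _ = _ := by ring

/-- Almost sure lower bound for the normalized sums of odd-indexed digits. -/
lemma ae_eventually_lt_oddDigitSum :
    ∀ᵐ x ∂gaussMeasure, ∀ c < 1 / log 2,
      ∀ᶠ k : ℕ in atTop, c < 1 / (k * log k) * oddDigitSum k x := by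
  have hl := log_pos one_lt_two
  filter_upwards [ae_all_iff.2 ae_eventually_le_oddDigitSum] with x hx c hc
  have ht : Tendsto (fun q : ℕ => (q : ℝ) / (q + 2) * (1 / log 2)) atTop (nhds (1 / log 2)) := by
    simpa using (tendsto_natCast_div_add_atTop (2 : ℝ)).mul_const (1 / log 2)
  obtain ⟨q, hq, hq0⟩ := ((ht.eventually_const_lt hc).and (eventually_ne_atTop 0)).exists
  refine eventually_lt_of_le_on_powers (oddDigitSum_mono x) (q := q) ?_ hq0 (hx q)
  rwa [div_mul_div_comm, mul_one] at hq

lemma gaussMeasure_lt_leadingDigit_le {N : ℕ} (hN : N ≠ 0) :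
    gaussMeasure {x | N < leadingDigit x} ≤ ENNReal.ofReal (2 / N) := by
  have hN' : (0 : ℝ) < N := by exact_mod_cast Nat.pos_of_ne_zero hN
  have hl := log_two_gt_d9
  have hms : MeasurableSet {x | N < leadingDigit x} :=
    measurable_leadingDigit measurableSet_Ioi
  rw [← lintegral_indicator_one hms, lintegral_gaussMeasure (measurable_one.indicator hms)]
  calc _ ≤ ∫⁻ x in Set.Ioo (0 : ℝ) 1, (Set.Ioc (0 : ℝ) (1 / N)).indicator
        (fun _ => ENNReal.ofReal 2) x := by
        refine setLIntegral_mono (measurable_const.indicator measurableSet_Ioc) fun x hx => ?_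
        by_cases h : N < leadingDigit x
        · have hx1 : x ≤ 1 / N := by
            have h1 : (N : ℤ) ≤ ⌊1 / x⌋ := by unfold leadingDigit at h; omega
            have h2 : (N : ℝ) ≤ 1 / x := by
              have := Int.le_floor.1 h1
              exact_mod_cast this
            rw [le_div_iff₀ hx.1] at h2
            rw [le_div_iff₀ hN']
            linarith
          rw [Set.indicator_of_mem (show x ∈ {x | N < leadingDigit x} from h),
            Set.indicator_of_mem (show x ∈ Set.Ioc (0 : ℝ) (1 / N) from ⟨hx.1, hx1⟩)]
          simp only [Pi.one_apply, mul_one]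
          apply ENNReal.ofReal_le_ofReal
          have hx0 := hx.1
          rw [div_le_iff₀ (by positivity)]
          nlinarith
        · rw [Set.indicator_of_notMem (show x ∉ {x | N < leadingDigit x} from h), mul_zero]
          exact zero_le
    _ ≤ ∫⁻ x, (Set.Ioc (0 : ℝ) (1 / N)).indicator (fun _ => ENNReal.ofReal 2) x :=
        setLIntegral_le_lintegral _ _
    _ = ENNReal.ofReal (2 / N) := by
        rw [lintegral_indicator measurableSet_Ioc, setLIntegral_const, Real.volume_Ioc,
          ← ENNReal.ofReal_mul (by norm_num)]
        congr 1
        ring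

lemma gaussMeasure_truncOddDigitSum_ne_le {N : ℕ} (hN : N ≠ 0) (n : ℕ) :
    gaussMeasure {x | truncOddDigitSum N n x ≠ oddDigitSum n x} ≤
      ENNReal.ofReal (n * (2 / N)) := by
  have hsub : {x | truncOddDigitSum N n x ≠ oddDigitSum n x} ⊆
      ⋃ i ∈ Finset.range n, gaussMap^[2 * i] ⁻¹' {x | N < leadingDigit x} := by
    intro x hx
    by_contra hcon
    simp only [Set.mem_iUnion, not_exists, Set.mem_preimage, Set.mem_ofPred_eq, not_lt] at hcon
    exact hx (Finset.sum_congr rfl fun i hi => if_pos (hcon i hi))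
  refine (measure_mono hsub).trans ((measure_biUnion_finset_le _ _).trans ?_)
  have hms : MeasurableSet {x | N < leadingDigit x} :=
    measurable_leadingDigit measurableSet_Ioi
  refine (Finset.sum_le_card_nsmul _ _ (ENNReal.ofReal (2 / N)) fun i _ => ?_).trans (le_of_eq ?_)
  · rw [(measurePreserving_gaussMap.iterate (2 * i)).measure_preimage hms.nullMeasurableSet]
    exact gaussMeasure_lt_leadingDigit_le hN
  · rw [Finset.card_range, nsmul_eq_mul, ENNReal.ofReal_mul n.cast_nonneg, ENNReal.ofReal_natCast]

lemma lintegral_truncOddDigitSum (N n : ℕ) {a : ℝ} (ha : 0 ≤ a) :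
    ∫⁻ x, ENNReal.ofReal (a * truncOddDigitSum N n x) ∂gaussMeasure =
      ENNReal.ofReal (a * (n * truncMean N)) := by
  have hT := measurable_truncDigit N
  have h1 : ∀ i, ∫⁻ x, ENNReal.ofReal (truncDigit N (gaussMap^[2 * i] x)) ∂gaussMeasure =
      ENNReal.ofReal (truncMean N) := fun i => by
    rw [ofReal_truncMean]
    exact (measurePreserving_gaussMap.iterate (2 * i)).lintegral_comp hT.ennreal_ofReal
  simp_rw [ENNReal.ofReal_mul ha]
  rw [lintegral_const_mul _ (measurable_truncOddDigitSum N n).ennreal_ofReal]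
  congr 1
  simp_rw [truncOddDigitSum, ENNReal.ofReal_sum_of_nonneg fun i _ => truncDigit_nonneg N _]
  have hTi : ∀ i, Measurable fun x => ENNReal.ofReal (truncDigit N (gaussMap^[2 * i] x)) :=
    fun i => (hT.comp (measurable_gaussMap.iterate (2 * i))).ennreal_ofReal
  rw [lintegral_finsetSum _ fun i _ => hTi i]
  simp only [h1]
  rw [Finset.sum_const, Finset.card_range, nsmul_eq_mul, ENNReal.ofReal_mul n.cast_nonneg,
    ENNReal.ofReal_natCast]

lemma tendsto_log_succ_div_succ :
    Tendsto (fun j : ℕ => log ((j : ℝ) + 1) / (j + 1)) atTop (nhds 0) := by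
  have h := isLittleO_log_id_atTop.tendsto_div_nhds_zero.comp
    (tendsto_atTop_add_const_right _ (1 : ℝ) tendsto_natCast_atTop_atTop)
  exact h

/-- The normalized sums of odd-indexed digits are frequently close to `1 / log 2`. -/
lemma ae_frequently_oddDigitSum_lt :
    ∀ᵐ x ∂gaussMeasure, ∀ c > 1 / log 2,
      ∃ᶠ k : ℕ in atTop, 1 / (k * log k) * oddDigitSum k x < c := by
  have hl := log_pos one_lt_two
  set n : ℕ → ℕ := fun j => 2 ^ (j + 1)
  set N : ℕ → ℕ := fun j => (j + 1) ^ 2 * 2 ^ (j + 1)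
  set a : ℕ → ℝ := fun j => 1 / (n j * log (n j))
  have hlogn : ∀ j, log (n j) = (j + 1) * log 2 := fun j => by
    simp only [n]; push_cast; rw [log_pow]; push_cast; ring
  have hn0 : ∀ j, (0 : ℝ) < n j := fun j => by simp only [n]; positivity
  have ha : ∀ j, 0 ≤ a j := fun j => by
    have := hn0 j
    simp only [a, hlogn]
    positivity
  have hnt : Tendsto n atTop atTop :=
    (tendsto_pow_atTop_atTop_of_one_lt one_lt_two).comp (tendsto_add_atTop_nat 1)
  have hsum : ∑' j, gaussMeasure {x | truncOddDigitSum (N j) (n j) x ≠ oddDigitSum (n j) x} ≠ ⊤ := by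
    refine ne_top_of_le_ne_top (summable_div_succ_sq 2).tsum_ofReal_ne_top
      (ENNReal.tsum_le_tsum fun j => ?_)
    refine (gaussMeasure_truncOddDigitSum_ne_le (by positivity) (n j)).trans (le_of_eq ?_)
    congr 1
    simp only [n, N]
    push_cast
    field_simp
  set u : ℕ → ℝ → ENNReal := fun j x => ENNReal.ofReal (a j * truncOddDigitSum (N j) (n j) x)
  have hum : ∀ j, Measurable (u j) := fun j =>
    ((measurable_truncOddDigitSum _ _).const_mul _).ennreal_ofReal
  have hint : ∫⁻ x, liminf (fun j => u j x) atTop ∂gaussMeasure ≤ ENNReal.ofReal (1 / log 2) := by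
    refine (lintegral_liminf_le hum).trans ?_
    have ht : Tendsto (fun j : ℕ => ENNReal.ofReal
        ((1 + 1 / log 2 * (1 / ((j : ℝ) + 1) + 2 * (log (j + 1) / (j + 1)))) / log 2)) atTop
        (nhds (ENNReal.ofReal (1 / log 2))) := by
      refine ENNReal.tendsto_ofReal ?_
      have h := (((tendsto_one_div_add_atTop_nhds_zero_nat (𝕜 := ℝ)).add
        (tendsto_log_succ_div_succ.const_mul 2)).const_mul (1 / log 2)).const_add 1
      simpa using h.div_const (log 2)
    rw [← ht.liminf_eq]
    refine liminf_le_liminf (Eventually.of_forall fun j => ?_)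
    simp only [u]
    rw [lintegral_truncOddDigitSum _ _ (ha j)]
    apply ENNReal.ofReal_le_ofReal
    have hn := hn0 j
    have hlogN : log (N j) = 2 * log (j + 1) + (j + 1) * log 2 := by
      simp only [N]
      push_cast
      rw [log_mul (by positivity) (by positivity), log_pow, log_pow]
      push_cast
      ring
    have h1 := truncMean_le (N j)
    rw [hlogN] at h1
    calc a j * (n j * truncMean (N j)) = truncMean (N j) / ((j + 1) * log 2) := by
          simp only [a, hlogn]; field_simp
      _ ≤ (1 + (2 * log (j + 1) + (j + 1) * log 2)) / log 2 / ((j + 1) * log 2) := by gcongr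
      _ = _ := by field_simp; ring
  have hge : (fun _ => ENNReal.ofReal (1 / log 2)) ≤ᵐ[gaussMeasure]
      fun x => liminf (fun j => u j x) atTop := by
    filter_upwards [ae_eventually_notMem hsum, ae_eventually_lt_oddDigitSum] with x hx hA
    refine le_of_forall_lt_imp_le_of_dense fun b hb => ?_
    have hbt : b ≠ ⊤ := hb.ne_top
    rw [ENNReal.lt_ofReal_iff_toReal_lt hbt] at hb
    refine le_liminf_of_le (by isBoundedDefault) ?_
    filter_upwards [hx, hnt.eventually (hA _ hb)] with j hj hlt
    rw [not_not] at hj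
    simp only [u, hj]
    rw [← ENNReal.ofReal_toReal hbt]
    exact ENNReal.ofReal_le_ofReal hlt.le
  have heq := ae_eq_of_ae_le_of_lintegral_le hge (by simp)
    (Measurable.liminf hum).aemeasurable (by simpa using hint)
  filter_upwards [ae_eventually_notMem hsum, heq] with x hx hxe c hc
  have hc0 : 0 < c := lt_trans (by positivity) hc
  have hlt : liminf (fun j => u j x) atTop < ENNReal.ofReal c := by
    rw [← hxe]
    exact (ENNReal.ofReal_lt_ofReal_iff hc0).2 hc
  refine hnt.frequently (((frequently_lt_of_liminf_lt (by isBoundedDefault) hlt).and_eventually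
    hx).mono ?_)
  rintro j ⟨h1, h2⟩
  rw [not_not] at h2
  simp only [u, h2] at h1
  exact (ENNReal.ofReal_lt_ofReal_iff hc0).1 h1

lemma liminf_eq_of_eventually_lt_of_frequently_lt {u : ℕ → ℝ} {l : ℝ}
    (h1 : ∀ c < l, ∀ᶠ k in atTop, c < u k) (h2 : ∀ c > l, ∃ᶠ k in atTop, u k < c) :
    liminf u atTop = l := by
  have hb : IsBoundedUnder (· ≥ ·) atTop u :=
    ⟨l - 1, by simpa using (h1 (l - 1) (by linarith)).mono fun k hk => hk.le⟩
  have hcb : IsCoboundedUnder (· ≥ ·) atTop u :=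
    IsCoboundedUnder.of_frequently_le ((h2 (l + 1) (by linarith)).mono fun k hk => hk.le)
  refine le_antisymm (le_of_forall_gt_imp_ge_of_dense fun c hc => ?_)
    (le_of_forall_lt_imp_le_of_dense fun c hc => ?_)
  · exact liminf_le_of_frequently_le ((h2 c hc).mono fun k hk => hk.le) hb
  · exact le_liminf_of_le hcb ((h1 c hc).mono fun k hk => hk.le)

/-- For a.e. irrational `x ∈ (0,1)`:
`liminf (1/(k log k)) ∑_{i=1}^k a_{2i-1}(x) = 1/log 2`. -/
theorem rcf_odd_digit_sum_liminf :
    ∀ᵐ x ∂(volume.restrict (Set.Ioo (0 : ℝ) 1)), Irrational x →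
      Filter.liminf
        (fun k : ℕ =>
          (1 / (k * Real.log k)) * ∑ i ∈ Finset.Icc 1 k, (rcfDigit x (2 * i - 1) : ℝ))
        atTop = 1 / Real.log 2 := by
  refine restrict_absolutelyContinuous_gaussMeasure.ae_le ?_
  filter_upwards [ae_eventually_lt_oddDigitSum, ae_frequently_oddDigitSum_lt] with x h1 h2 _
  simp_rw [sum_rcfDigit_eq_oddDigitSum]
  exact liminf_eq_of_eventually_lt_of_frequently_lt h1 h2
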